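/- arXiv:2107.07102 — 4 statements merged into one kernel-verified Lean document; each statement's English description precedes it below -/
import Mathlib

section
/- Let n ≥ 2 and N ≥ 1 be integers. For each integer i define c_i := |{k ∈ ℕ : 1 ≤ k ≤ nN−1 and 2·⌈2k/n⌉ − 2 = i}| + |{k ∈ ℕ : 1 ≤ k ≤ nN−1 and 2·⌊2k/n⌋ = i}|, where ⌈·⌉ and ⌊·⌋ denote the ceiling and floor of the rational number 2k/n. Then c_0 = n−1, c_{4N−2} = n−1, c_i = n for every even integer i with 0 < i < 4N−2, and c_i = 0 for every other integer i (in particular for all odd i, all i < 0, and all i > 4N−2). -/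
theorem ceil_two_mul_div_eq_add_one_iff {n : ℕ} (hn : 0 < n) (k : ℕ) (j : ℤ) :
    ⌈(2 * (k : ℚ)) / (n : ℚ)⌉ = j + 1 ↔ j * n < 2 * k ∧ 2 * (k : ℤ) ≤ j * n + n := by
  have hn' : (0 : ℚ) < n := by exact_mod_cast hn
  rw [Int.ceil_eq_iff, lt_div_iff₀ hn', div_le_iff₀ hn', ← add_one_mul j (n : ℤ)]
  push_cast
  rw [add_sub_cancel_right]
  norm_cast

theorem floor_two_mul_div_eq_iff {n : ℕ} (hn : 0 < n) (k : ℕ) (j : ℤ) :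
    ⌊(2 * (k : ℚ)) / (n : ℚ)⌋ = j ↔ j * n ≤ 2 * k ∧ 2 * (k : ℤ) < j * n + n := by
  have hn' : (0 : ℚ) < n := by exact_mod_cast hn
  rw [Int.floor_eq_iff, le_div_iff₀ hn', div_lt_iff₀ hn', ← add_one_mul j (n : ℤ)]
  norm_cast

/-- For `a + n ≤ 2 * M`, the half-open windows `(a, a + n]` and `[a, a + n)` for `2 * k`, restricted
to `1 ≤ k ≤ M - 1`, contain `n` points in total, minus one for each boundary point cut off. -/
theorem card_filter_windows {a n M : ℕ} (hn : 0 < n) (h : a + n ≤ 2 * M) :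
    ((Finset.Icc 1 (M - 1)).filter (fun k => a < 2 * k ∧ 2 * k ≤ a + n)).card +
      ((Finset.Icc 1 (M - 1)).filter (fun k => a ≤ 2 * k ∧ 2 * k < a + n)).card +
      (if a = 0 then 1 else 0) + (if a + n = 2 * M then 1 else 0) = n := by
  have h₁ : (Finset.Icc 1 (M - 1)).filter (fun k => a < 2 * k ∧ 2 * k ≤ a + n) =
      Finset.Icc (a / 2 + 1) (min ((a + n) / 2) (M - 1)) := by
    ext k
    simp only [Finset.mem_filter, Finset.mem_Icc]
    omega
  have h₂ : (Finset.Icc 1 (M - 1)).filter (fun k => a ≤ 2 * k ∧ 2 * k < a + n) =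
      Finset.Ico (max 1 ((a + 1) / 2)) ((a + n + 1) / 2) := by
    ext k
    simp only [Finset.mem_filter, Finset.mem_Icc, Finset.mem_Ico]
    omega
  rw [h₁, h₂, Nat.card_Icc, Nat.card_Ico]
  split_ifs <;> omega

/-- Grading count for the lens space `S³/ℤ_n`: for `n ≥ 2`, `N ≥ 1`, and
`c_i` the number of orbits `γ_s^k` (grading `2⌈2k/n⌉ − 2`) and `γ_n^k` (grading `2⌊2k/n⌋`)
with `1 ≤ k ≤ nN − 1` of grading `i`, one has `c_0 = c_{4N−2} = n − 1`, `c_i = n` for even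
`0 < i < 4N−2`, and `c_i = 0` otherwise. -/
theorem lens_space_grading_count (n N : ℕ) (hn : 2 ≤ n) (hN : 1 ≤ N) (c : ℤ → ℕ)
    (hc : ∀ i : ℤ, c i =
      ((Finset.Icc 1 (n * N - 1)).filter
        (fun k : ℕ => 2 * ⌈(2 * (k : ℚ)) / (n : ℚ)⌉ - 2 = i)).card +
      ((Finset.Icc 1 (n * N - 1)).filter
        (fun k : ℕ => 2 * ⌊(2 * (k : ℚ)) / (n : ℚ)⌋ = i)).card) :
    c 0 = n - 1 ∧
    c (4 * (N : ℤ) - 2) = n - 1 ∧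
    (∀ i : ℤ, Even i → 0 < i → i < 4 * (N : ℤ) - 2 → c i = n) ∧
    (∀ i : ℤ, i ≠ 0 → i ≠ 4 * (N : ℤ) - 2 →
      ¬(Even i ∧ 0 < i ∧ i < 4 * (N : ℤ) - 2) → c i = 0) := by
  have hn₀ : 0 < n := by omega
  have key : ∀ j : ℕ, j < 2 * N →
      c (2 * j) + (if j = 0 then 1 else 0) + (if j + 1 = 2 * N then 1 else 0) = n := by
    intro j hj
    have hle : j * n + n ≤ 2 * (n * N) := by nlinarith
    have e₁ : j * n = 0 ↔ j = 0 := by simp [hn₀.ne']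
    have e₂ : j * n + n = 2 * (n * N) ↔ j + 1 = 2 * N := by
      rw [← add_one_mul, show 2 * (n * N) = 2 * N * n by ring, Nat.mul_left_inj hn₀.ne']
    have hw := card_filter_windows hn₀ hle
    simp only [e₁, e₂] at hw
    have p₁ : ∀ k : ℕ, 2 * ⌈(2 * (k : ℚ)) / (n : ℚ)⌉ - 2 = 2 * (j : ℤ) ↔
        j * n < 2 * k ∧ 2 * k ≤ j * n + n := by
      intro k
      have := ceil_two_mul_div_eq_add_one_iff hn₀ k j
      norm_cast at this ⊢
      rw [← this]
      push_cast
      omega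
    have p₂ : ∀ k : ℕ, 2 * ⌊(2 * (k : ℚ)) / (n : ℚ)⌋ = 2 * (j : ℤ) ↔
        j * n ≤ 2 * k ∧ 2 * k < j * n + n := by
      intro k
      have := floor_two_mul_div_eq_iff hn₀ k j
      norm_cast at this ⊢
      rw [← this]
      omega
    rw [hc]
    simpa only [p₁, p₂] using hw
  refine ⟨?_, ?_, ?_, ?_⟩
  · have := key 0 (by omega)
    simp only [Nat.cast_zero, mul_zero] at this
    split_ifs at this <;> omega
  · have := key (2 * N - 1) (by omega)
    rw [show (2 * ((2 * N - 1 : ℕ) : ℤ)) = 4 * (N : ℤ) - 2 by omega] at this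
    split_ifs at this <;> omega
  · rintro i ⟨m, rfl⟩ h₀ h₁
    have := key m.toNat (by omega)
    rw [show (2 * (m.toNat : ℤ)) = m + m by omega] at this
    split_ifs at this <;> omega
  · intro i h₀ h₁ h₂
    have hbound : ∀ k ∈ Finset.Icc 1 (n * N - 1), 0 < k ∧ k < n * N := by
      intro k hk
      rw [Finset.mem_Icc] at hk
      omega
    rw [hc, Nat.add_eq_zero_iff, Finset.card_eq_zero, Finset.card_eq_zero,
      Finset.filter_eq_empty_iff, Finset.filter_eq_empty_iff]
    have main : ∀ m : ℤ, i = 2 * m → m < 0 ∨ 2 * N ≤ m := by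
      rintro m rfl
      by_contra! hm
      exact h₂ ⟨even_two_mul m, by omega, by omega⟩
    have hout : ∀ m : ℤ, i = 2 * m → m * n + n ≤ 0 ∨ 2 * ((n : ℤ) * N) ≤ m * n := by
      intro m hm
      rcases main m hm with h | h
      · left; nlinarith
      · right; nlinarith
    constructor
    · intro k hk hi
      have hb := hbound k hk
      zify at hb
      set x := ⌈(2 * (k : ℚ)) / (n : ℚ)⌉ with hx
      have hk' := (ceil_two_mul_div_eq_add_one_iff hn₀ k (x - 1)).1 (by omega)
      have := hout (x - 1) (by omega)
      omega
    · intro k hk hi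
      have hb := hbound k hk
      zify at hb
      have hk' := (floor_two_mul_div_eq_iff hn₀ k _).1 rfl
      have := hout _ hi.symm
      omega
end

section
/- Let n ≥ 1 and N ≥ 1 be integers. For each integer i define c_i := |{k ∈ ℕ : 1 ≤ k ≤ 4N−1 and 2·⌈k/2⌉ − 2 = i}| + |{k ∈ ℕ : 1 ≤ k ≤ 4N−1 and k − 1 = i}| + |{k ∈ ℕ : 1 ≤ k ≤ 2nN−1 and 2·⌊k/n⌋ = i}|, where ⌈·⌉ and ⌊·⌋ denote the ceiling and floor of the rational numbers k/2 and k/n. Then c_i = 0 for i < 0 and for i > 4N−2; c_0 = n+2 and c_{4N−2} = n+2; c_i = n+3 for every even integer i with 0 < i < 4N−2; and c_i = 1 for every odd integer i with 0 < i < 4N−2. -/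
theorem ceil_natCast_div_two (k : ℕ) : ⌈(k : ℚ) / 2⌉ = ((k + 1) / 2 : ℕ) := by
  have h := Rat.ceil_natCast_div_natCast k 2
  push_cast at h ⊢
  omega

/-- The indices `k` of the orbits `e₋^k` of grading `2m`. -/
theorem filter_two_mul_ceil_sub_two (M m : ℕ) :
    (Finset.Icc 1 M).filter (fun k : ℕ => 2 * ⌈(k : ℚ) / 2⌉ - 2 = 2 * (m : ℤ)) =
      Finset.Icc (2 * m + 1) (min (2 * m + 2) M) := by
  ext k
  simp only [Finset.mem_filter, Finset.mem_Icc, ceil_natCast_div_two]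
  omega

/-- The indices `k` of the orbits `h^k` of grading `i`. -/
theorem filter_natCast_sub_one (M i : ℕ) (hi : i < M) :
    (Finset.Icc 1 M).filter (fun k : ℕ => (k : ℤ) - 1 = i) = {i + 1} := by
  ext k
  simp only [Finset.mem_filter, Finset.mem_Icc, Finset.mem_singleton]
  omega

/-- The indices `k` of the orbits `e₊^k` of grading `2m`. -/
theorem filter_two_mul_floor (n L m : ℕ) (hn : 1 ≤ n) (hm : m < L) :
    (Finset.Icc 1 (n * L - 1)).filter (fun k : ℕ => 2 * ⌊(k : ℚ) / (n : ℚ)⌋ = 2 * (m : ℤ)) =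
      Finset.Ico (max 1 (m * n)) (m * n + n) := by
  have hle : m * n + n ≤ n * L := by nlinarith
  ext k
  have hdiv : k / n = m ↔ m * n ≤ k ∧ k < m * n + n := by
    rw [Nat.div_eq_iff (by omega)]
    omega
  simp only [Finset.mem_filter, Finset.mem_Icc, Finset.mem_Ico, Rat.floor_natCast_div_natCast]
  omega

/-- Grading count for `S³/𝔻*₂ₙ` (Lemma 3.1): for `n ≥ 1`, `N ≥ 1`, and `c_i`
the number of orbits `e₋^k` (grading `2⌈k/2⌉ − 2`, `1 ≤ k ≤ 4N−1`), `h^k` (grading `k − 1`,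
`1 ≤ k ≤ 4N−1`) and `e₊^k` (grading `2⌊k/n⌋`, `1 ≤ k ≤ 2nN−1`) of grading `i`: `c_i = 0` for
`i < 0` or `i > 4N−2`; `c_0 = c_{4N−2} = n+2`; `c_i = n+3` for even `0 < i < 4N−2`; and
`c_i = 1` for odd `0 < i < 4N−2`. -/
theorem binary_dihedral_grading_count (n N : ℕ) (hn : 1 ≤ n) (hN : 1 ≤ N) (c : ℤ → ℕ)
    (hc : ∀ i : ℤ, c i =
      ((Finset.Icc 1 (4 * N - 1)).filter
        (fun k : ℕ => 2 * ⌈(k : ℚ) / 2⌉ - 2 = i)).card +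
      ((Finset.Icc 1 (4 * N - 1)).filter
        (fun k : ℕ => (k : ℤ) - 1 = i)).card +
      ((Finset.Icc 1 (2 * n * N - 1)).filter
        (fun k : ℕ => 2 * ⌊(k : ℚ) / (n : ℚ)⌋ = i)).card) :
    (∀ i : ℤ, i < 0 → c i = 0) ∧
    (∀ i : ℤ, 4 * (N : ℤ) - 2 < i → c i = 0) ∧
    c 0 = n + 2 ∧
    c (4 * (N : ℤ) - 2) = n + 2 ∧
    (∀ i : ℤ, Even i → 0 < i → i < 4 * (N : ℤ) - 2 → c i = n + 3) ∧
    (∀ i : ℤ, Odd i → 0 < i → i < 4 * (N : ℤ) - 2 → c i = 1) := by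
  have e_minus_parity : ∀ k : ℕ, Even (2 * ⌈(k : ℚ) / 2⌉ - 2) := fun k => by
    simp
  have vanish : ∀ i : ℤ, i < 0 ∨ 4 * (N : ℤ) - 2 < i → c i = 0 := by
    intro i hi
    rw [hc]
    simp only [Nat.add_eq_zero_iff, Finset.card_eq_zero, Finset.filter_eq_empty_iff,
      Finset.mem_Icc]
    refine ⟨⟨fun k hk => ?_, fun k hk => ?_⟩, fun k hk => ?_⟩
    · rw [ceil_natCast_div_two]
      omega
    · omega
    · have hlt : k / n < 2 * N := by
        rw [Nat.div_lt_iff_lt_mul (by omega), show 2 * N * n = 2 * n * N by ring]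
        omega
      have hnonneg : (0 : ℤ) ≤ (k : ℤ) / n := by positivity
      rw [Rat.floor_natCast_div_natCast]
      omega
  have even_count : ∀ m : ℕ, m < 2 * N → c (2 * (m : ℤ)) =
      (min (2 * m + 2) (4 * N - 1) - 2 * m) + 1 + (m * n + n - max 1 (m * n)) := by
    intro m hm
    have h := filter_natCast_sub_one (4 * N - 1) (2 * m) (by omega)
    push_cast at h
    rw [hc, filter_two_mul_ceil_sub_two, h, show 2 * n * N = n * (2 * N) by ring,
      filter_two_mul_floor n (2 * N) m hn hm, Nat.card_Icc, Finset.card_singleton, Nat.card_Ico]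
    omega
  refine ⟨fun i hi => vanish i (.inl hi), fun i hi => vanish i (.inr hi), ?_, ?_, ?_, ?_⟩
  · have h := even_count 0 (by omega)
    simp only [Nat.cast_zero, mul_zero, zero_mul] at h
    omega
  · have h := even_count (2 * N - 1) (by omega)
    have hpos : 1 ≤ (2 * N - 1) * n := Nat.mul_pos (by omega) hn
    rw [show 4 * (N : ℤ) - 2 = 2 * ((2 * N - 1 : ℕ) : ℤ) by omega, h]
    omega
  · intro i hi hpos hlt
    obtain ⟨m, rfl⟩ : ∃ m : ℕ, i = 2 * (m : ℤ) := by
      obtain ⟨r, rfl⟩ := hi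
      exact ⟨r.toNat, by omega⟩
    have hmn : 1 ≤ m * n := Nat.mul_pos (by omega) hn
    rw [even_count m (by omega)]
    omega
  · intro i hi hpos hlt
    lift i to ℕ using hpos.le
    rw [hc, filter_natCast_sub_one _ _ (by omega), Finset.card_singleton,
      Finset.filter_false_of_mem, Finset.filter_false_of_mem]
    · simp
    · intro k _ h
      exact (Int.not_even_iff_odd.2 hi) (h ▸ even_two_mul _)
    · intro k _ h
      exact (Int.not_even_iff_odd.2 hi) (h ▸ e_minus_parity k)
end

section
/- Let a ≥ 2 and N ≥ 1 be integers and set m = a + 4. For each integer i define c_i := |{k ∈ ℕ : 1 ≤ k ≤ 2aN−1 and 2·⌈k/a⌉ − 2 = i}| + |{k ∈ ℕ : 1 ≤ k ≤ 4N−1 and k − 1 = i}| + |{k ∈ ℕ : 1 ≤ k ≤ 6N−1 and 2·⌊k/3⌋ = i}|, where ⌈·⌉ and ⌊·⌋ denote the ceiling and floor of the rational numbers k/a and k/3. Then c_i = 0 for i < 0 and for i > 4N−2; c_0 = m−1 and c_{4N−2} = m−1; c_i = m for every even integer i with 0 < i < 4N−2; and c_i = 1 for every odd integer i with 0 < i <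 4N−2. -/
theorem filter_two_mul_ceil_div_eq (a M j : ℕ) (ha : 0 < a) :
    (Finset.Icc 1 M).filter (fun k : ℕ => 2 * ⌈(k : ℚ) / (a : ℚ)⌉ - 2 = 2 * (j : ℤ)) =
      Finset.Icc (a * j + 1) (min M (a * j + a)) := by
  have ha' : (0 : ℚ) < a := by exact_mod_cast ha
  ext k
  have h : 2 * ⌈(k : ℚ) / (a : ℚ)⌉ - 2 = 2 * (j : ℤ) ↔ a * j < k ∧ k ≤ a * j + a := by
    have h₁ : 2 * ⌈(k : ℚ) / (a : ℚ)⌉ - 2 = 2 * (j : ℤ) ↔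
        ⌈(k : ℚ) / (a : ℚ)⌉ = (j : ℤ) + 1 := by omega
    rw [h₁, Int.ceil_eq_iff, lt_div_iff₀ ha', div_le_iff₀ ha']
    push_cast
    rw [add_sub_cancel_right, mul_comm (j : ℚ), add_mul, one_mul, mul_comm (j : ℚ)]
    norm_cast
  simp only [Finset.mem_filter, Finset.mem_Icc, h, le_min_iff]
  omega

theorem filter_two_mul_floor_div_three_eq (M j : ℕ) :
    (Finset.Icc 1 M).filter (fun k : ℕ => 2 * ⌊(k : ℚ) / 3⌋ = 2 * (j : ℤ)) =
      Finset.Icc (max 1 (3 * j)) (min M (3 * j + 2)) := by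
  ext k
  have h : ⌊(k : ℚ) / 3⌋ = (k : ℤ) / 3 := by
    simpa using Rat.floor_intCast_div_natCast (k : ℤ) 3
  simp only [Finset.mem_filter, Finset.mem_Icc, h]
  omega

theorem filter_sub_one_eq (M j : ℕ) :
    (Finset.Icc 1 M).filter (fun k : ℕ => (k : ℤ) - 1 = (j : ℤ)) =
      Finset.Icc (j + 1) (min M (j + 1)) := by
  ext k
  simp only [Finset.mem_filter, Finset.mem_Icc]
  omega


/-- Grading count for `S³/ℙ*` (Lemma 3.2): for `a ≥ 2`, `N ≥ 1`, `m = a + 4`,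
and `c_i` the number of orbits `𝒱^k` (grading `2⌈k/a⌉ − 2`, `1 ≤ k ≤ 2aN−1`), `ℰ^k` (grading
`k − 1`, `1 ≤ k ≤ 4N−1`) and `ℱ^k` (grading `2⌊k/3⌋`, `1 ≤ k ≤ 6N−1`) of grading `i`:
`c_i = 0` for `i < 0` or `i > 4N−2`; `c_0 = c_{4N−2} = m−1`; `c_i = m` for even `0 < i < 4N−2`;
and `c_i = 1` for odd `0 < i < 4N−2`. -/
theorem binary_polyhedral_grading_count (a N : ℕ) (ha : 2 ≤ a) (hN : 1 ≤ N)
    (m : ℕ) (hm : m = a + 4) (c : ℤ → ℕ)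
    (hc : ∀ i : ℤ, c i =
      ((Finset.Icc 1 (2 * a * N - 1)).filter
        (fun k : ℕ => 2 * ⌈(k : ℚ) / (a : ℚ)⌉ - 2 = i)).card +
      ((Finset.Icc 1 (4 * N - 1)).filter
        (fun k : ℕ => (k : ℤ) - 1 = i)).card +
      ((Finset.Icc 1 (6 * N - 1)).filter
        (fun k : ℕ => 2 * ⌊(k : ℚ) / 3⌋ = i)).card) :
    (∀ i : ℤ, i < 0 → c i = 0) ∧
    (∀ i : ℤ, 4 * (N : ℤ) - 2 < i → c i = 0) ∧
    c 0 = m - 1 ∧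
    c (4 * (N : ℤ) - 2) = m - 1 ∧
    (∀ i : ℤ, Even i → 0 < i → i < 4 * (N : ℤ) - 2 → c i = m) ∧
    (∀ i : ℤ, Odd i → 0 < i → i < 4 * (N : ℤ) - 2 → c i = 1) := by
  have ha₀ : 0 < a := by omega
  have c_neg (i : ℤ) (hi : i < 0) : c i = 0 := by
    rw [hc]
    simp only [Nat.add_eq_zero_iff, Finset.card_eq_zero, Finset.filter_eq_empty_iff,
      Finset.mem_Icc]
    refine ⟨⟨fun k hk h => ?_, fun k hk h => by omega⟩, fun k hk h => ?_⟩
    · have hk₀ : (0 : ℚ) < k := by exact_mod_cast hk.1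
      have : 0 < ⌈(k : ℚ) / (a : ℚ)⌉ := Int.ceil_pos.2 (by positivity)
      omega
    · have : 0 ≤ ⌊(k : ℚ) / 3⌋ := Int.floor_nonneg.2 (by positivity)
      omega
  have c_even (j : ℕ) : c (2 * (j : ℤ)) =
      (min (2 * a * N - 1) (a * j + a) - a * j) +
      (min (4 * N - 1) (2 * j + 1) - 2 * j) +
      (min (6 * N - 1) (3 * j + 2) + 1 - max 1 (3 * j)) := by
    have h := filter_sub_one_eq (4 * N - 1) (2 * j)
    push_cast at h
    rw [hc, filter_two_mul_ceil_div_eq a _ j ha₀, h, filter_two_mul_floor_div_three_eq]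
    simp only [Nat.card_Icc, Nat.add_sub_add_right]
  have c_odd (j : ℕ) : c (2 * (j : ℤ) + 1) = min (4 * N - 1) (2 * j + 2) - (2 * j + 1) := by
    have h := filter_sub_one_eq (4 * N - 1) (2 * j + 1)
    push_cast at h
    rw [hc, h, Finset.filter_false_of_mem (fun k _ => by omega),
      Finset.filter_false_of_mem (fun k _ => by omega)]
    simp only [Nat.card_Icc, Nat.add_sub_add_right, Finset.card_empty, zero_add, add_zero]
  have c_mid (j : ℕ) (hj : 0 < j) (hjN : j + 1 < 2 * N) : c (2 * (j : ℤ)) = m := by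
    have : a * (j + 2) ≤ a * (2 * N) := Nat.mul_le_mul_left a hjN
    rw [c_even, mul_comm 2 a, mul_assoc]
    rw [mul_add] at this
    omega
  refine ⟨c_neg, fun i hi => ?_, ?_, ?_, fun i hi h₀ h₁ => ?_, fun i hi h₀ h₁ => ?_⟩
  · lift i to ℕ using by omega
    obtain ⟨j, rfl | rfl⟩ := i.even_or_odd'
    · have : a * (2 * N) ≤ a * j := Nat.mul_le_mul_left a (by omega)
      push_cast
      rw [c_even, mul_comm 2 a, mul_assoc]
      omega
    · push_cast
      rw [c_odd]
      omega
  · have : a * 2 ≤ a * (2 * N) := Nat.mul_le_mul_left a (by omega)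
    have h := c_even 0
    rw [mul_comm 2 a, mul_assoc] at h
    simp only [Nat.cast_zero, mul_zero] at h
    omega
  · obtain ⟨n, rfl⟩ : ∃ n, N = n + 1 := ⟨N - 1, by omega⟩
    have h := c_even (2 * n + 1)
    have e : 2 * a * (n + 1) = a * (2 * n + 1) + a := by ring
    rw [e] at h
    have e' : 4 * ((n + 1 : ℕ) : ℤ) - 2 = 2 * ((2 * n + 1 : ℕ) : ℤ) := by push_cast; ring
    rw [e', h]
    omega
  · lift i to ℕ using h₀.le
    obtain ⟨j, rfl | rfl⟩ := i.even_or_odd'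
    · push_cast
      exact c_mid j (by omega) (by omega)
    · grind
  · lift i to ℕ using h₀.le
    obtain ⟨j, rfl | rfl⟩ := i.even_or_odd'
    · grind
    · push_cast
      rw [c_odd]
      omega
end

section
/- Let n ≥ 2 be an integer. For a sign σ ∈ {+1, −1} and an integer k ≥ 1 define: cz(σ,k) = 2·⌊2k/n⌋ + 1 if σ = +1 and cz(σ,k) = 2·⌈2k/n⌉ − 1 if σ = −1; cls(σ,k) = the residue class of σ·k in ℤ/nℤ; and, for a real number ε, act(σ,k,ε) = (2πk/n)·(1 + σ·ε). Then: (a) for all signs σ₊, σ₋ and all integers k₊, k₋ ≥ 1, if cls(σ₊,k₊) = cls(σ₋,k₋) and cz(σ₊,k₊) = cz(σ₋,k₋), then σ₊ = σ₋ and k₊ = k₋; (b) for every integer K ≥ 1 there exists ε₀ > 0 such that for all ε₊, ε₋ ∈ (0, ε₀], all signs σ₊, σ₋, and all integers k₊, k₋ with 1 ≤ k₊, k₋ ≤ K, if cls(σ₊,k₊) = cls(σ₋,k₋) and cz(σ₊,k₊) < cz(σ₋,k₋), then act(σ₊,k₊,ε₊) < act(σ₋,k₋,ε₋). -/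
noncomputable section

/-- Conley–Zehnder index: `cz n 1 k = 2⌊2k/n⌋ + 1` (the orbit `γ_n^k`) and
`cz n (−1) k = 2⌈2k/n⌉ − 1` (the orbit `γ_s^k`). -/
def cz (n : ℕ) (σ : ℤ) (k : ℕ) : ℤ :=
  if σ = 1 then 2 * ⌊(2 * (k : ℚ)) / (n : ℚ)⌋ + 1 else 2 * ⌈(2 * (k : ℚ)) / (n : ℚ)⌉ - 1

/-- Free homotopy class: the residue class of `σ·k` in `ℤ/nℤ`. -/
def cls (n : ℕ) (σ : ℤ) (k : ℕ) : ZMod n := ((σ * (k : ℤ) : ℤ) : ZMod n)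

/-- Action: `act n σ k ε = (2πk/n)·(1 + σ·ε)`. -/
def act (n : ℕ) (σ : ℤ) (k : ℕ) (ε : ℝ) : ℝ :=
  (2 * Real.pi * (k : ℝ) / (n : ℝ)) * (1 + (σ : ℝ) * ε)

theorem exists_cz_one_eq {n : ℕ} (hn : 0 < n) (k : ℕ) :
    ∃ f : ℤ, cz n 1 k = 2 * f + 1 ∧ n * f ≤ 2 * (k : ℤ) ∧ 2 * (k : ℤ) < n * (f + 1) := by
  have hn' : (0 : ℚ) < n := by exact_mod_cast hn
  refine ⟨⌊(2 * (k : ℚ)) / (n : ℚ)⌋, if_pos rfl, ?_, ?_⟩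
  · have h := Int.floor_le ((2 * (k : ℚ)) / (n : ℚ))
    rw [le_div_iff₀ hn', mul_comm] at h
    exact_mod_cast h
  · have h := Int.lt_floor_add_one ((2 * (k : ℚ)) / (n : ℚ))
    rw [div_lt_iff₀ hn', mul_comm _ (n : ℚ)] at h
    exact_mod_cast h

theorem exists_cz_neg_one_eq {n : ℕ} (hn : 0 < n) (k : ℕ) :
    ∃ c : ℤ, cz n (-1) k = 2 * c - 1 ∧ n * (c - 1) < 2 * (k : ℤ) ∧ 2 * (k : ℤ) ≤ n * c := by
  have hn' : (0 : ℚ) < n := by exact_mod_cast hn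
  refine ⟨⌈(2 * (k : ℚ)) / (n : ℚ)⌉, if_neg (by decide), ?_, ?_⟩
  · have h := Int.ceil_lt_add_one ((2 * (k : ℚ)) / (n : ℚ))
    rw [← sub_lt_iff_lt_add, lt_div_iff₀ hn', mul_comm] at h
    exact_mod_cast h
  · have h := Int.le_ceil ((2 * (k : ℚ)) / (n : ℚ))
    rw [div_le_iff₀ hn', mul_comm _ (n : ℚ)] at h
    exact_mod_cast h

theorem exists_mul_eq_sub_of_cls_eq {n : ℕ} {σ τ : ℤ} {k l : ℕ} (h : cls n σ k = cls n τ l) :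
    ∃ t : ℤ, τ * l - σ * k = n * t :=
  (ZMod.intCast_eq_intCast_iff_dvd_sub _ _ _).1 h

theorem eq_of_sub_eq_mul_of_window {n a b m t : ℤ} (hn : 0 < n) (ht : b - a = n * t)
    (ha : m ≤ 2 * a ∧ 2 * a ≤ m + n) (hb : m ≤ 2 * b ∧ 2 * b ≤ m + n) : a = b := by
  have h1 : t < 1 := by nlinarith
  have h2 : -1 < t := by nlinarith
  obtain rfl : t = 0 := by omega
  linarith

theorem cz_one_ne_cz_neg_one {n : ℕ} (hn : 0 < n) {k l : ℕ} (hc : cls n 1 k = cls n (-1) l) :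
    cz n 1 k ≠ cz n (-1) l := by
  intro h
  obtain ⟨t, ht⟩ := exists_mul_eq_sub_of_cls_eq hc
  obtain ⟨f, hf, hf1, hf2⟩ := exists_cz_one_eq hn k
  obtain ⟨c, hcz, hc1, hc2⟩ := exists_cz_neg_one_eq hn l
  obtain rfl : c = f + 1 := by omega
  have hn' : (0 : ℤ) < n := by exact_mod_cast hn
  have h1 : f < -t := by nlinarith
  have h2 : -t < f + 1 := by nlinarith
  omega

theorem eq_of_cls_eq_of_cz_eq {n : ℕ} (hn : 0 < n) {σ τ : ℤ} (hσ : σ = 1 ∨ σ = -1)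
    (hτ : τ = 1 ∨ τ = -1) {k l : ℕ} (hc : cls n σ k = cls n τ l) (h : cz n σ k = cz n τ l) :
    σ = τ ∧ k = l := by
  have hn' : (0 : ℤ) < n := by exact_mod_cast hn
  obtain ⟨t, ht⟩ := exists_mul_eq_sub_of_cls_eq hc
  rcases hσ with rfl | rfl <;> rcases hτ with rfl | rfl
  · obtain ⟨f, hf, hf1, hf2⟩ := exists_cz_one_eq hn k
    obtain ⟨g, hg, hg1, hg2⟩ := exists_cz_one_eq hn l
    obtain rfl : f = g := by omega
    have := eq_of_sub_eq_mul_of_window (a := k) (b := l) (m := n * f) (t := t) hn' (by linarith)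
      ⟨hf1, by linarith⟩ ⟨hg1, by linarith⟩
    exact ⟨rfl, by exact_mod_cast this⟩
  · exact absurd h (cz_one_ne_cz_neg_one hn hc)
  · exact absurd h.symm (cz_one_ne_cz_neg_one hn hc.symm)
  · obtain ⟨f, hf, hf1, hf2⟩ := exists_cz_neg_one_eq hn k
    obtain ⟨g, hg, hg1, hg2⟩ := exists_cz_neg_one_eq hn l
    obtain rfl : f = g := by omega
    have := eq_of_sub_eq_mul_of_window (a := l) (b := k) (m := n * (f - 1)) (t := t) hn'
      (by linarith) ⟨by linarith, by linarith⟩ ⟨by linarith, by linarith⟩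
    exact ⟨rfl, by exact_mod_cast this.symm⟩

theorem lt_or_eq_of_cz_lt {n : ℕ} (hn : 0 < n) {σ τ : ℤ} (hσ : σ = 1 ∨ σ = -1)
    (hτ : τ = 1 ∨ τ = -1) {k l : ℕ} (h : cz n σ k < cz n τ l) :
    k < l ∨ (k = l ∧ σ = -1 ∧ τ = 1) := by
  have hn' : (0 : ℤ) < n := by exact_mod_cast hn
  rcases hσ with rfl | rfl <;> rcases hτ with rfl | rfl
  · obtain ⟨f, hf, hf1, hf2⟩ := exists_cz_one_eq hn k
    obtain ⟨g, hg, hg1, hg2⟩ := exists_cz_one_eq hn l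
    have := mul_le_mul_of_nonneg_left (show f + 1 ≤ g by omega) hn'.le
    omega
  · obtain ⟨f, hf, hf1, hf2⟩ := exists_cz_one_eq hn k
    obtain ⟨g, hg, hg1, hg2⟩ := exists_cz_neg_one_eq hn l
    have := mul_le_mul_of_nonneg_left (show f + 1 ≤ g - 1 by omega) hn'.le
    omega
  · obtain ⟨f, hf, hf1, hf2⟩ := exists_cz_neg_one_eq hn k
    obtain ⟨g, hg, hg1, hg2⟩ := exists_cz_one_eq hn l
    have := mul_le_mul_of_nonneg_left (show f ≤ g by omega) hn'.le
    omega
  · obtain ⟨f, hf, hf1, hf2⟩ := exists_cz_neg_one_eq hn k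
    obtain ⟨g, hg, hg1, hg2⟩ := exists_cz_neg_one_eq hn l
    have := mul_le_mul_of_nonneg_left (show f ≤ g - 1 by omega) hn'.le
    omega

theorem act_lt_act {n : ℕ} (hn : 0 < n) {σ τ : ℤ} {k l : ℕ} {ε δ : ℝ}
    (h : k * (1 + σ * ε) < l * (1 + τ * δ)) : act n σ k ε < act n τ l δ := by
  have hc : (0 : ℝ) < 2 * Real.pi / n := by positivity
  calc act n σ k ε = 2 * Real.pi / n * (k * (1 + σ * ε)) := by unfold act; ring
    _ < 2 * Real.pi / n * (l * (1 + τ * δ)) := mul_lt_mul_of_pos_left h hc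
    _ = act n τ l δ := by unfold act; ring

/-- For `n ≥ 2`: (a) two orbit data `(σ₊,k₊)`, `(σ₋,k₋)` with the same free
homotopy class and the same Conley–Zehnder index coincide; (b) for every bound `K ≥ 1` there
is `ε₀ > 0` so that for perturbation parameters in `(0, ε₀]`, equal free homotopy class and
strictly smaller Conley–Zehnder index forces strictly smaller action. -/
theorem lens_space_index_action_comparison (n : ℕ) (hn : 2 ≤ n) :
    (∀ σp σm : ℤ, (σp = 1 ∨ σp = -1) → (σm = 1 ∨ σm = -1) →
      ∀ kp km : ℕ, 1 ≤ kp → 1 ≤ km →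
      cls n σp kp = cls n σm km → cz n σp kp = cz n σm km →
      σp = σm ∧ kp = km) ∧
    (∀ K : ℕ, 1 ≤ K → ∃ ε₀ : ℝ, 0 < ε₀ ∧
      ∀ εp εm : ℝ, εp ∈ Set.Ioc 0 ε₀ → εm ∈ Set.Ioc 0 ε₀ →
      ∀ σp σm : ℤ, (σp = 1 ∨ σp = -1) → (σm = 1 ∨ σm = -1) →
      ∀ kp km : ℕ, 1 ≤ kp → kp ≤ K → 1 ≤ km → km ≤ K →
      cls n σp kp = cls n σm km → cz n σp kp < cz n σm km →
      act n σp kp εp < act n σm km εm) := by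
  have hn0 : 0 < n := by omega
  refine ⟨fun σp σm hp hm kp km _ _ hc h => eq_of_cls_eq_of_cz_eq hn0 hp hm hc h, ?_⟩
  intro K hK
  have hK' : (0 : ℝ) < K := by exact_mod_cast hK
  refine ⟨1 / (4 * K), by positivity, ?_⟩
  rintro εp εm ⟨hp0, hp1⟩ ⟨hm0, hm1⟩ σp σm hσp hσm kp km hkp hkpK _ hkmK _ h
  apply act_lt_act hn0
  rcases lt_or_eq_of_cz_lt hn0 hσp hσm h with hlt | ⟨rfl, rfl, rfl⟩
  · have small : ∀ {k : ℕ} {ε : ℝ}, k ≤ K → 0 < ε → ε ≤ 1 / (4 * K) →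
        0 ≤ k * ε ∧ k * ε ≤ 1 / 4 := by
      intro k ε hk h0 h1
      refine ⟨by positivity, ?_⟩
      calc (k : ℝ) * ε ≤ K * (1 / (4 * K)) := by gcongr
        _ = 1 / 4 := by field_simp
    have hlt' : (kp : ℝ) + 1 ≤ km := by exact_mod_cast hlt
    obtain ⟨h1, h2⟩ := small hkpK hp0 hp1
    obtain ⟨h3, h4⟩ := small hkmK hm0 hm1
    rcases hσp with rfl | rfl <;> rcases hσm with rfl | rfl <;> push_cast <;> linarith
  · have hk : (0 : ℝ) < kp := by exact_mod_cast hkp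
    apply mul_lt_mul_of_pos_left _ hk
    push_cast
    linarith

end
end
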